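/- Let Σ be a topologically transitive one-sided Markov shift over the countable alphabet ℤ₊ and A : Σ → ℝ a potential of summable variation. If x ∈ Ω(A), then φ_A(x,y) = h_A(x,y) and this common value is a real number (finite), for every y ∈ Σ. -/

import Mathlib

open MeasureTheory Filter Set
open scoped ENNReal

namespace CMS

/-- The one-sided Markov shift `Σ` over the countable alphabet `ℕ = ℤ₊`,
determined by the transition matrix `Tr`. -/
abbrev SS (Tr : ℕ → ℕ → Prop) : Type := {x : ℕ → ℕ // ∀ n, Tr (x n) (x (n + 1))}

/-- The left shift map `σ`. -/
def shiftMap (Tr : ℕ → ℕ → Prop) (x : SS Tr) : SS Tr :=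
  ⟨fun n => x.1 (n + 1), fun n => x.2 (n + 1)⟩

open scoped Classical in
/-- The metric `d(x,y) = λ^ℓ`, `ℓ` the first index of disagreement (`0` if `x = y`). -/
noncomputable def sdist (lam : ℝ) {Tr : ℕ → ℕ → Prop} (x y : SS Tr) : ℝ :=
  if h : ∃ n, x.1 n ≠ y.1 n then lam ^ Nat.find h else 0

/-- Birkhoff sum `S_n f`. -/
noncomputable def birk {Tr : ℕ → ℕ → Prop} (f : SS Tr → ℝ) (n : ℕ) (x : SS Tr) : ℝ :=
  ∑ i ∈ Finset.range n, f ((shiftMap Tr)^[i] x)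

/-- `ℓ`-th variation of `f` restricted to a subset `s` (valued in `ℝ≥0∞`). -/
noncomputable def varAtOn (lam : ℝ) {Tr : ℕ → ℕ → Prop} (s : Set (SS Tr))
    (f : SS Tr → ℝ) (ℓ : ℕ) : ℝ≥0∞ :=
  ⨆ (x ∈ s) (y ∈ s) (_ : sdist lam x y ≤ lam ^ ℓ), ENNReal.ofReal (f x - f y)

/-- `ℓ`-th variation `Var_ℓ(f)`. -/
noncomputable def varAt (lam : ℝ) {Tr : ℕ → ℕ → Prop} (f : SS Tr → ℝ) (ℓ : ℕ) : ℝ≥0∞ :=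
  varAtOn lam Set.univ f ℓ

/-- `Var_k^∞(f) = ∑_{ℓ ≥ k} Var_ℓ(f)`. -/
noncomputable def varFrom (lam : ℝ) {Tr : ℕ → ℕ → Prop} (f : SS Tr → ℝ) (k : ℕ) : ℝ≥0∞ :=
  ∑' ℓ : ℕ, varAt lam f (k + ℓ)

/-- `f` has summable variation: `Var_1^∞(f) < ∞`. -/
def SummableVar (lam : ℝ) {Tr : ℕ → ℕ → Prop} (f : SS Tr → ℝ) : Prop :=
  varFrom lam f 1 < ⊤

/-- `f` is locally Hölder continuous: `Var_ℓ(f) ≤ C λ^ℓ` for all `ℓ ≥ 1`. -/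
def LocHolder (lam : ℝ) {Tr : ℕ → ℕ → Prop} (f : SS Tr → ℝ) : Prop :=
  ∃ C : ℝ, 0 < C ∧ ∀ ℓ : ℕ, 1 ≤ ℓ → varAt lam f ℓ ≤ ENNReal.ofReal (C * lam ^ ℓ)

/-- `‖A - B‖_sv = Var_1^∞(A-B) + ‖A-B‖_∞`. -/
noncomputable def svDist (lam : ℝ) {Tr : ℕ → ℕ → Prop} (A B : SS Tr → ℝ) : ℝ≥0∞ :=
  varFrom lam (fun x => A x - B x) 1 + ⨆ x : SS Tr, ENNReal.ofReal |A x - B x|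

/-- `A` is a potential: continuous and bounded from above. -/
def IsPotential {Tr : ℕ → ℕ → Prop} (A : SS Tr → ℝ) : Prop :=
  Continuous A ∧ BddAbove (Set.range A)

/-- Topological transitivity of the shift. -/
def TopTransitive (Tr : ℕ → ℕ → Prop) : Prop :=
  ∀ U V : Set (SS Tr), IsOpen U → IsOpen V → U.Nonempty → V.Nonempty →
    ∃ n : ℕ, ((shiftMap Tr)^[n] '' U ∩ V).Nonempty

/-- The ergodic maximizing constant `β_A`. -/
noncomputable def beta {Tr : ℕ → ℕ → Prop} (A : SS Tr → ℝ) : ℝ :=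
  sSup {r : ℝ | ∃ μ : Measure (SS Tr), IsProbabilityMeasure μ ∧
    μ.map (shiftMap Tr) = μ ∧ r = ∫ x, A x ∂μ}

/-- `μ` is an `A`-maximizing (shift-invariant Borel probability) measure. -/
def Maximizing {Tr : ℕ → ℕ → Prop} (A : SS Tr → ℝ) (μ : Measure (SS Tr)) : Prop :=
  IsProbabilityMeasure μ ∧ μ.map (shiftMap Tr) = μ ∧ ∫ x, A x ∂μ = beta A

/-- Topological support of a measure. -/
def msupport {Tr : ℕ → ℕ → Prop} (μ : Measure (SS Tr)) : Set (SS Tr) :=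
  {x | ∀ U : Set (SS Tr), IsOpen U → x ∈ U → 0 < μ U}

/-- `μ` is the uniform probability measure on a periodic orbit. -/
def PeriodicOrbitMeasure {Tr : ℕ → ℕ → Prop} (μ : Measure (SS Tr)) : Prop :=
  ∃ (y : SS Tr) (p : ℕ), 1 ≤ p ∧ (shiftMap Tr)^[p] y = y ∧
    μ = (p : ℝ≥0∞)⁻¹ • ∑ i ∈ Finset.range p, Measure.dirac ((shiftMap Tr)^[i] y)

/-- `A` is coercive: `lim_{i→∞} sup A|_[i] = -∞`. -/
def Coercive {Tr : ℕ → ℕ → Prop} (A : SS Tr → ℝ) : Prop :=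
  ∀ M : ℝ, ∃ N : ℕ, ∀ i : ℕ, N ≤ i → ∀ x : SS Tr, x.1 0 = i → A x ≤ M

/-- The Aubry set `Ω(A)`. -/
def Aubry (lam : ℝ) {Tr : ℕ → ℕ → Prop} (A : SS Tr → ℝ) : Set (SS Tr) :=
  {x | ∀ ε : ℝ, 0 < ε → ∃ (w : SS Tr) (n : ℕ), 0 < n ∧
    sdist lam x w < ε ∧ sdist lam ((shiftMap Tr)^[n] w) x < ε ∧
    -ε < (n : ℝ) * beta A - birk A n w ∧ (n : ℝ) * beta A - birk A n w < ε}

/-- The auxiliary function `𝔖^k_l(x,y)` at level `γ`. -/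
noncomputable def aux (lam : ℝ) {Tr : ℕ → ℕ → Prop} (A : SS Tr → ℝ) (γ : ℝ)
    (k l : ℕ) (x y : SS Tr) : EReal :=
  ⨅ (n : ℕ) (_ : l ≤ n) (w : SS Tr)
    (_ : sdist lam x w ≤ lam ^ k) (_ : sdist lam ((shiftMap Tr)^[n] w) y ≤ lam ^ k),
    (((n : ℝ) * γ - birk A n w : ℝ) : EReal)

/-- The Mañé potential `φ^γ_A(x,y)`. -/
noncomputable def mane (lam : ℝ) {Tr : ℕ → ℕ → Prop} (A : SS Tr → ℝ) (γ : ℝ)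
    (x y : SS Tr) : EReal :=
  ⨆ k : ℕ, aux lam A γ k 1 x y

/-- The Peierls barrier `h^γ_A(x,y)`. -/
noncomputable def peierls (lam : ℝ) {Tr : ℕ → ℕ → Prop} (A : SS Tr → ℝ) (γ : ℝ)
    (x y : SS Tr) : EReal :=
  ⨆ (k : ℕ) (l : ℕ), aux lam A γ k (l + 1) x y

section Gluing

variable {Tr : ℕ → ℕ → Prop}

/-- `a` and `b` share their first `k` symbols. -/
def Agree (k : ℕ) (a b : SS Tr) : Prop := ∀ i < k, a.1 i = b.1 i

lemma Agree.symm {k : ℕ} {a b : SS Tr} (h : Agree k a b) : Agree k b a :=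
  fun i hi => (h i hi).symm

lemma Agree.trans {k : ℕ} {a b c : SS Tr} (h : Agree k a b) (h' : Agree k b c) : Agree k a c :=
  fun i hi => (h i hi).trans (h' i hi)

lemma Agree.mono {k l : ℕ} {a b : SS Tr} (h : Agree l a b) (hkl : k ≤ l) : Agree k a b :=
  fun i hi => h i (hi.trans_le hkl)

lemma sdist_le_pow_iff {lam : ℝ} (h0 : 0 < lam) (h1 : lam < 1) (k : ℕ) (a b : SS Tr) :
    sdist lam a b ≤ lam ^ k ↔ Agree k a b := by
  classical
  unfold sdist Agree
  split_ifs with h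
  · rw [pow_le_pow_iff_right_of_lt_one₀ h0 h1, Nat.le_find_iff]
    simp
  · push Not at h
    simp [h, h0.le]

lemma iterate_shiftMap_apply (n : ℕ) (a : SS Tr) (i : ℕ) :
    ((shiftMap Tr)^[n] a).1 i = a.1 (i + n) := by
  induction n generalizing i with
  | zero => rfl
  | succ n ih =>
    rw [Function.iterate_succ_apply']
    refine (ih (i + 1)).trans ?_
    rw [Nat.add_right_comm, Nat.add_assoc]

lemma birk_add (f : SS Tr → ℝ) (m n : ℕ) (a : SS Tr) :
    birk f (m + n) a = birk f m a + birk f n ((shiftMap Tr)^[m] a) := by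
  simp only [birk, Finset.sum_range_add, ← Function.iterate_add_apply, Nat.add_comm]

lemma birk_mul_of_periodic (f : SS Tr → ℝ) {n : ℕ} {p : SS Tr} (hp : (shiftMap Tr)^[n] p = p)
    (N : ℕ) : (shiftMap Tr)^[N * n] p = p ∧ birk f (N * n) p = N * birk f n p := by
  induction N with
  | zero => simp [birk]
  | succ N ih =>
    rw [Nat.succ_mul]
    refine ⟨?_, ?_⟩
    · rw [Function.iterate_add_apply, hp, ih.1]
    · rw [birk_add, ih.1, ih.2]
      push_cast
      ring

/-- A point following `a` for `n` steps and then `b`. -/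
lemma exists_glue (n : ℕ) (a b : SS Tr) (hab : a.1 n = b.1 0) :
    ∃ z : SS Tr, Agree n z a ∧ (shiftMap Tr)^[n] z = b := by
  refine ⟨⟨fun i => if i < n then a.1 i else b.1 (i - n), fun i => ?_⟩, ?_, ?_⟩
  · dsimp only
    rcases lt_trichotomy (i + 1) n with h | h | h
    · rw [if_pos h, if_pos (by omega)]
      exact a.2 i
    · rw [if_pos (by omega), if_neg (by omega), h, Nat.sub_self, ← hab, ← h]
      exact a.2 i
    · rw [if_neg (by omega), if_neg (by omega), Nat.sub_add_comm (Nat.lt_succ_iff.1 h)]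
      exact b.2 _
  · intro i hi
    exact if_pos hi
  · apply Subtype.ext
    funext i
    rw [iterate_shiftMap_apply]
    simp

/-- If `w` returns to its initial symbol at time `n`, its first `n` symbols can be repeated
periodically. -/
lemma exists_periodic {n K : ℕ} (hn : 0 < n) (w : SS Tr)
    (hw : Agree (K + 1) ((shiftMap Tr)^[n] w) w) :
    ∃ p : SS Tr, (shiftMap Tr)^[n] p = p ∧ Agree (n + (K + 1)) p w := by
  have hw' : ∀ i < K + 1, w.1 (i + n) = w.1 i := fun i hi => by
    rw [← iterate_shiftMap_apply]
    exact hw i hi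
  refine ⟨⟨fun i => w.1 (i % n), fun i => ?_⟩, ?_, ?_⟩
  · have h := w.2 (i % n)
    dsimp only
    rw [Nat.add_mod i 1 n]
    rcases Nat.lt_or_ge (i % n + 1) n with h' | h'
    · have h1 : 1 % n = 1 := Nat.mod_eq_of_lt (by omega)
      rw [h1, Nat.mod_eq_of_lt h']
      exact h
    · have h2 : i % n + 1 = n := by
        have := Nat.mod_lt i hn
        omega
      have h3 : (i % n + 1 % n) % n = 0 := by
        rw [Nat.add_mod_mod, h2, Nat.mod_self]
      rw [h3]
      rw [h2] at h
      have h4 := hw' 0 (by omega)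
      rw [Nat.zero_add] at h4
      rwa [← h4]
  · apply Subtype.ext
    funext i
    rw [iterate_shiftMap_apply]
    simp
  · intro i
    induction i using Nat.strong_induction_on with
    | _ i ih =>
      intro hi
      rcases Nat.lt_or_ge i n with h | h
      · change w.1 (i % n) = w.1 i
        rw [Nat.mod_eq_of_lt h]
      · have h1 := ih (i - n) (by omega) (by omega)
        have h2 := hw' (i - n) (by omega)
        rw [Nat.sub_add_cancel h] at h2
        rw [h2, ← h1]
        change w.1 (i % n) = w.1 ((i - n) % n)
        rw [Nat.mod_eq_sub_mod h]

lemma exists_transit (htr : TopTransitive Tr) (a b : SS Tr) :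
    ∃ (u : SS Tr) (m : ℕ), u.1 0 = a.1 0 ∧ (shiftMap Tr)^[m] u = b := by
  have ho : ∀ c : ℕ, IsOpen {z : SS Tr | z.1 0 = c} := fun c =>
    (isOpen_discrete ({c} : Set ℕ)).preimage
      ((continuous_apply 0).comp continuous_subtype_val : Continuous fun z : SS Tr => z.1 0)
  obtain ⟨m, _, ⟨u, hu, rfl⟩, hm⟩ := htr _ _ (ho (a.1 0)) (ho (b.1 0)) ⟨a, rfl⟩ ⟨b, rfl⟩
  have hm' : u.1 m = b.1 0 := by
    have := iterate_shiftMap_apply m u 0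
    rw [Nat.zero_add] at this
    rw [← this]
    exact hm
  rcases Nat.eq_zero_or_pos m with rfl | hpos
  · exact ⟨b, 0, hm'.symm.trans hu, rfl⟩
  · obtain ⟨z, hz, hz'⟩ := exists_glue m u b hm'
    exact ⟨z, m, (hz 0 hpos).trans hu, hz'⟩

end Gluing

section Potential

variable {Tr : ℕ → ℕ → Prop} {lam : ℝ} {A : SS Tr → ℝ}

/-- Bounded distortion of Birkhoff sums along orbits sharing `n + K` symbols, with a bound
vanishing as `K → ∞`. -/
lemma exists_distortion_bound (h0 : 0 < lam) (h1 : lam < 1) (hA : SummableVar lam A) :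
    ∃ t : ℕ → ℝ, Tendsto t atTop (nhds 0) ∧
      ∀ K n (a b : SS Tr), Agree (n + K) a b → birk A n a - birk A n b ≤ t K := by
  have hne : (∑' l, varAt lam A (1 + l)) ≠ ⊤ := ne_of_lt hA
  have hfin : ∀ l, varAt lam A (1 + l) ≠ ⊤ := ENNReal.ne_top_of_tsum_ne_top hne
  set v : ℕ → ℝ := fun l => (varAt lam A (1 + l)).toReal with hv
  have hsum : Summable v := ENNReal.summable_toReal hne
  have hvar : ∀ l (a b : SS Tr), Agree (1 + l) a b → A a - A b ≤ v l := by
    intro l a b hab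
    apply (ENNReal.ofReal_le_iff_le_toReal (hfin l)).1
    exact le_iSup₂_of_le a trivial (le_iSup₂_of_le b trivial
      (le_iSup_of_le ((sdist_le_pow_iff h0 h1 _ a b).2 hab) le_rfl))
  refine ⟨fun K => ∑' i, v (i + K), tendsto_sum_nat_add v, fun K n a b hab => ?_⟩
  calc birk A n a - birk A n b
      = ∑ i ∈ Finset.range n, (A ((shiftMap Tr)^[i] a) - A ((shiftMap Tr)^[i] b)) := by
        simp [birk]
    _ ≤ ∑ i ∈ Finset.range n, v (n - 1 - i + K) := by
        refine Finset.sum_le_sum fun i hi => hvar _ _ _ fun j hj => ?_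
        have hi' := Finset.mem_range.1 hi
        rw [iterate_shiftMap_apply, iterate_shiftMap_apply]
        exact hab _ (by omega)
    _ = ∑ i ∈ Finset.range n, v (i + K) := Finset.sum_range_reflect (fun i => v (i + K)) n
    _ ≤ ∑' i, v (i + K) :=
        Summable.sum_le_tsum _ (fun _ _ => ENNReal.toReal_nonneg) ((summable_nat_add_iff K).2 hsum)

lemma measurable_shiftMap : Measurable (shiftMap Tr) :=
  Measurable.subtype_mk (f := fun (z : SS Tr) n => z.1 (n + 1)) (measurable_pi_lambda _ fun n =>
    (measurable_pi_apply (n + 1)).comp measurable_subtype_coe)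

lemma bddAbove_integrals (hA : IsPotential A) :
    BddAbove {r : ℝ | ∃ μ : Measure (SS Tr), IsProbabilityMeasure μ ∧
      μ.map (shiftMap Tr) = μ ∧ r = ∫ x, A x ∂μ} := by
  obtain ⟨M, hM⟩ := hA.2
  refine ⟨max M 0, ?_⟩
  rintro _ ⟨μ, hμ, -, rfl⟩
  by_cases hi : Integrable A μ
  · refine le_max_of_le_left ?_
    calc ∫ x, A x ∂μ ≤ ∫ _, M ∂μ :=
          integral_mono hi (integrable_const M) fun x => hM (mem_range_self x)
      _ = M := by simp
  · rw [integral_undef hi]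
    exact le_max_right _ _

/-- The Birkhoff average over a periodic orbit is at most `β_A`. -/
lemma birk_le_of_periodic (hA : IsPotential A) {n : ℕ} (hn : 0 < n) {p : SS Tr}
    (hp : (shiftMap Tr)^[n] p = p) : birk A n p ≤ n * beta A := by
  have hn' : (n : ℝ≥0∞) ≠ 0 := by exact_mod_cast hn.ne'
  set μ : Measure (SS Tr) :=
    (n : ℝ≥0∞)⁻¹ • ∑ i ∈ Finset.range n, Measure.dirac ((shiftMap Tr)^[i] p) with hμ
  have hprob : IsProbabilityMeasure μ := by
    refine ⟨?_⟩
    simp [hμ, ENNReal.inv_mul_cancel hn' (ENNReal.natCast_ne_top n)]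
  have hinv : μ.map (shiftMap Tr) = μ := by
    rw [hμ, Measure.map_smul, ← Measure.mapₗ_apply_of_measurable measurable_shiftMap, map_sum]
    simp only [Measure.mapₗ_apply_of_measurable measurable_shiftMap,
      Measure.map_dirac' measurable_shiftMap, ← Function.iterate_succ_apply' (shiftMap Tr)]
    congr 1
    have h := Finset.sum_range_succ' (fun i => Measure.dirac ((shiftMap Tr)^[i] p)) n
    rw [Finset.sum_range_succ, hp, Function.iterate_zero_apply] at h
    ext s hs
    have h' := congrArg (fun ν : Measure (SS Tr) => ν s) h
    simp only [Measure.add_apply] at h'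
    exact ((ENNReal.add_left_inj (measure_ne_top _ s)).1 h').symm
  have hint : ∫ x, A x ∂μ = (n : ℝ)⁻¹ * birk A n p := by
    rw [hμ, integral_smul_measure, integral_finsetSum_measure]
    · simp [birk, integral_dirac]
    · intro i _
      exact integrable_dirac (by simp)
  have hle : (n : ℝ)⁻¹ * birk A n p ≤ beta A :=
    le_csSup (bddAbove_integrals hA) ⟨μ, hprob, hinv, hint.symm⟩
  have hnR : (0 : ℝ) < n := by exact_mod_cast hn
  rwa [inv_mul_le_iff₀ hnR] at hle

/-- Near an Aubry point there are arbitrarily long, almost free periodic returns. -/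
lemma exists_periodic_of_mem_aubry (h0 : 0 < lam) (h1 : lam < 1) (hAsv : SummableVar lam A)
    {x : SS Tr} (hx : x ∈ Aubry lam A) (k l : ℕ) {ε : ℝ} (hε : 0 < ε) :
    ∃ (p : SS Tr) (n : ℕ), l ≤ n ∧ (shiftMap Tr)^[n] p = p ∧ Agree k p x ∧
      n * beta A - birk A n p < ε := by
  obtain ⟨t, ht, hdist⟩ := exists_distortion_bound h0 h1 hAsv
  set δ : ℝ := ε / (2 * (l + 1)) with hδ
  have hδ0 : 0 < δ := by positivity
  obtain ⟨K, hK, hkK⟩ := ((ht.comp (tendsto_add_atTop_nat 1)).eventually_lt_const hδ0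
    |>.and (eventually_ge_atTop k)).exists
  obtain ⟨w, n, hn, hxw, hwx, -, hcost⟩ := hx (min δ (lam ^ (K + 1))) (by positivity)
  have hxw' := (sdist_le_pow_iff h0 h1 _ _ _).1 (hxw.le.trans (min_le_right _ _))
  have hwx' := (sdist_le_pow_iff h0 h1 _ _ _).1 (hwx.le.trans (min_le_right _ _))
  obtain ⟨p, hp, hpw⟩ := exists_periodic hn w (hwx'.trans hxw')
  have hd := hdist (K + 1) n w p hpw.symm
  have hcost' := hcost.trans_le (min_le_left _ _)
  obtain ⟨hpN, hbN⟩ := birk_mul_of_periodic A hp (l + 1)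
  refine ⟨p, (l + 1) * n, by nlinarith, hpN,
    ((hpw.mono (by omega)).trans (hxw'.mono (by omega)).symm), ?_⟩
  rw [hbN]
  have h2 : n * beta A - birk A n p < 2 * δ := by
    simp only [Function.comp_apply] at hK
    linarith
  have h3 : ((l : ℝ) + 1) * (2 * δ) = ε := by
    rw [hδ]
    field_simp
  push_cast
  nlinarith [mul_lt_mul_of_pos_left h2 (by positivity : (0 : ℝ) < l + 1)]

lemma aux_le (h0 : 0 < lam) (h1 : lam < 1) {γ : ℝ} {k l n : ℕ} {x y w : SS Tr} (hn : l ≤ n)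
    (hxw : Agree k x w) (hwy : Agree k ((shiftMap Tr)^[n] w) y) :
    aux lam A γ k l x y ≤ ((n * γ - birk A n w : ℝ) : EReal) :=
  iInf₂_le_of_le n hn (iInf₂_le_of_le w ((sdist_le_pow_iff h0 h1 _ _ _).2 hxw)
    (iInf_le_of_le ((sdist_le_pow_iff h0 h1 _ _ _).2 hwy) le_rfl))

lemma le_aux (h0 : 0 < lam) (h1 : lam < 1) {γ : ℝ} {k l : ℕ} {x y : SS Tr} {c : EReal}
    (h : ∀ n (w : SS Tr), l ≤ n → Agree k x w → Agree k ((shiftMap Tr)^[n] w) y →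
      c ≤ ((n * γ - birk A n w : ℝ) : EReal)) :
    c ≤ aux lam A γ k l x y :=
  le_iInf₂ fun n hn => le_iInf₂ fun w hxw => le_iInf fun hwy =>
    h n w hn ((sdist_le_pow_iff h0 h1 _ _ _).1 hxw) ((sdist_le_pow_iff h0 h1 _ _ _).1 hwy)

lemma exists_of_aux_lt (h0 : 0 < lam) (h1 : lam < 1) {γ : ℝ} {k l : ℕ} {x y : SS Tr} {c : EReal}
    (h : aux lam A γ k l x y < c) :
    ∃ n, ∃ w : SS Tr, l ≤ n ∧ Agree k x w ∧ Agree k ((shiftMap Tr)^[n] w) y ∧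
      ((n * γ - birk A n w : ℝ) : EReal) < c := by
  by_contra! hcon
  exact absurd h (not_lt.2 (le_aux h0 h1 hcon))

lemma mane_le_peierls (γ : ℝ) (x y : SS Tr) : mane lam A γ x y ≤ peierls lam A γ x y :=
  iSup_mono fun _ => le_iSup_of_le 0 le_rfl

lemma exists_le_mane (h0 : 0 < lam) (h1 : lam < 1) (htr : TopTransitive Tr) (hA : IsPotential A)
    (hAsv : SummableVar lam A) (x y : SS Tr) :
    ∃ c : ℝ, (c : EReal) ≤ mane lam A (beta A) x y := by
  obtain ⟨t, -, hdist⟩ := exists_distortion_bound h0 h1 hAsv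
  obtain ⟨u, m, hu, hm⟩ := exists_transit htr y x
  refine ⟨-(t 1 + t 0 + (m * beta A - birk A m u)),
    le_iSup_of_le 1 (le_aux h0 h1 fun n w hn hxw hwy => ?_)⟩
  have hwn : w.1 n = u.1 0 := by
    have := iterate_shiftMap_apply n w 0
    rw [Nat.zero_add] at this
    rw [← this, hu]
    exact hwy 0 one_pos
  obtain ⟨z, hz, hzu⟩ := exists_glue n w u hwn
  have hreturn : Agree (0 + 1) ((shiftMap Tr)^[n + m] z) z := by
    rw [Nat.add_comm n m, Function.iterate_add_apply, hzu, hm]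
    exact hxw.trans (hz.mono hn).symm
  obtain ⟨p, hp, hpz⟩ := exists_periodic (by omega) z hreturn
  have hpb := birk_le_of_periodic hA (by omega) hp
  have hd1 := hdist 1 (n + m) z p hpz.symm
  have hd0 := hdist 0 n w z hz.symm
  rw [birk_add A n m z, hzu] at hd1
  push_cast at hpb
  exact_mod_cast (by linarith :
    -(t 1 + t 0 + (m * beta A - birk A m u)) ≤ n * beta A - birk A n w)

lemma exists_peierls_le (h0 : 0 < lam) (h1 : lam < 1) (htr : TopTransitive Tr)
    (hAsv : SummableVar lam A) {x : SS Tr} (hx : x ∈ Aubry lam A) (y : SS Tr) :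
    ∃ c : ℝ, peierls lam A (beta A) x y ≤ c := by
  obtain ⟨t, -, hdist⟩ := exists_distortion_bound h0 h1 hAsv
  obtain ⟨u, m, hu, hm⟩ := exists_transit htr x y
  refine ⟨1 + t 0 + (m * beta A - birk A m u), iSup₂_le fun k l => ?_⟩
  obtain ⟨p, n, hn, hp, hpx, hcost⟩ :=
    exists_periodic_of_mem_aubry h0 h1 hAsv hx (k + 1) (k + l + 1) one_pos
  have hpn : p.1 n = u.1 0 := by
    have := iterate_shiftMap_apply n p 0
    rw [Nat.zero_add, hp] at this
    rw [← this, hu]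
    exact hpx 0 (by omega)
  obtain ⟨z, hz, hzu⟩ := exists_glue n p u hpn
  have hzy : (shiftMap Tr)^[n + m] z = y := by
    rw [Nat.add_comm n m, Function.iterate_add_apply, hzu, hm]
  refine (aux_le h0 h1 (n := n + m) (w := z) (by omega)
    ((hpx.mono (by omega)).symm.trans (hz.mono (by omega)).symm) ?_).trans ?_
  · rw [hzy]
    exact fun _ _ => rfl
  · have hd := hdist 0 n p z hz.symm
    rw [birk_add A n m z, hzu, EReal.coe_le_coe_iff]
    push_cast
    linarith

lemma peierls_le_mane (h0 : 0 < lam) (h1 : lam < 1) (hAsv : SummableVar lam A) {x : SS Tr}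
    (hx : x ∈ Aubry lam A) (y : SS Tr) :
    peierls lam A (beta A) x y ≤ mane lam A (beta A) x y := by
  obtain ⟨t, ht, hdist⟩ := exists_distortion_bound h0 h1 hAsv
  refine iSup₂_le fun k l => EReal.le_of_forall_lt_iff_le.1 fun c hc => ?_
  obtain ⟨d, hd, hdc⟩ := EReal.lt_iff_exists_real_btwn.1 hc
  have hdc' : d < c := EReal.coe_lt_coe_iff.1 hdc
  obtain ⟨K, hK, hkK⟩ := (ht.eventually_lt_const (by linarith : 0 < (c - d) / 2)
    |>.and (eventually_ge_atTop (k + 1))).exists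
  obtain ⟨n, w, hn, hxw, hwy, hcost⟩ :=
    exists_of_aux_lt h0 h1 ((le_iSup (fun k => aux lam A (beta A) k 1 x y) K).trans_lt hd)
  have hcost' := EReal.coe_lt_coe_iff.1 hcost
  obtain ⟨p, q, hq, hp, hpx, hpcost⟩ :=
    exists_periodic_of_mem_aubry h0 h1 hAsv hx K (K + l) (by linarith : 0 < (c - d) / 2)
  have hpw := hpx.trans hxw
  have hpq : ∀ i, p.1 (i + q) = p.1 i := fun i => by rw [← iterate_shiftMap_apply, hp]
  obtain ⟨z, hz, hzw⟩ := exists_glue q p w (by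
    have := hpq 0
    rw [Nat.zero_add] at this
    exact this.trans (hpw 0 (by omega)))
  have hzp : Agree (q + K) z p := fun i hi => by
    rcases Nat.lt_or_ge i q with h | h
    · exact hz i h
    · have e1 := iterate_shiftMap_apply q z (i - q)
      have e2 := hpq (i - q)
      rw [Nat.sub_add_cancel h] at e1 e2
      rw [← e1, hzw, e2]
      exact (hpw _ (by omega)).symm
  have hdz := hdist K q p z hzp.symm
  refine (aux_le h0 h1 (n := q + n) (w := z) (by omega)
    ((hpx.symm.trans (hzp.mono (by omega)).symm).mono (by omega)) ?_).trans ?_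
  · rw [Nat.add_comm q n, Function.iterate_add_apply, hzw]
    exact hwy.mono (by omega)
  · rw [birk_add A q n z, hzw, EReal.coe_le_coe_iff]
    push_cast
    linarith

end Potential

theorem aubry_mane_eq_peierls_real_valued
    (lam : ℝ) (hlam0 : 0 < lam) (hlam1 : lam < 1)
    (Tr : ℕ → ℕ → Prop) (htr : TopTransitive Tr)
    (A : SS Tr → ℝ) (hA : IsPotential A) (hAsv : SummableVar lam A)
    (x : SS Tr) (hx : x ∈ Aubry lam A) :
    ∀ y : SS Tr, ∃ r : ℝ,
      mane lam A (beta A) x y = (r : EReal) ∧ peierls lam A (beta A) x y = (r : EReal) := by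
  intro y
  have heq := le_antisymm (mane_le_peierls (beta A) x y) (peierls_le_mane hlam0 hlam1 hAsv hx y)
  obtain ⟨c, hc⟩ := exists_le_mane hlam0 hlam1 htr hA hAsv x y
  obtain ⟨C, hC⟩ := exists_peierls_le hlam0 hlam1 htr hAsv hx y
  rw [← heq] at hC ⊢
  have hr := EReal.coe_toReal (ne_top_of_le_ne_top (EReal.coe_ne_top C) hC)
    (ne_bot_of_le_ne_bot (EReal.coe_ne_bot c) hc)
  exact ⟨_, hr.symm, hr.symm⟩

end CMS
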